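/- Let f : 3^N → ℝ be a bisubmodular function with f(∅,∅) = 0. Then Q_f, the convex hull of {(x,z) ∈ {−1,0,1}^n × ℝ : f(x) ≤ z}, equals the set of all (x,z) ∈ ℝ^n × ℝ such that −1 ≤ x_i ≤ 1 for all i ∈ N and π·x ≤ z for every extreme point π of the bisubmodular polyhedron P_f. -/

import Mathlib

open Finset

/-- A function `f` on pairs of disjoint subsets of `{0, …, n-1}` is bisubmodular. -/
def Bisubmodular (n : ℕ) (f : Finset (Fin n) → Finset (Fin n) → ℝ) : Prop :=
  ∀ X₁ X₂ Y₁ Y₂ : Finset (Fin n), Disjoint X₁ X₂ → Disjoint Y₁ Y₂ →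
    f (X₁ ∩ Y₁) (X₂ ∩ Y₂) + f ((X₁ ∪ Y₁) \ (X₂ ∪ Y₂)) ((X₂ ∪ Y₂) \ (X₁ ∪ Y₁)) ≤
      f X₁ X₂ + f Y₁ Y₂

/-- `x` is a ternary (±1/0) vector. -/
def IsTernary (n : ℕ) (x : Fin n → ℝ) : Prop := ∀ i, x i = -1 ∨ x i = 0 ∨ x i = 1

/-- The set `S₁ˣ = {i : x i = 1}`. -/
noncomputable def posSet (n : ℕ) (x : Fin n → ℝ) : Finset (Fin n) :=
  Finset.univ.filter (fun i => x i = 1)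

/-- The set `S₂ˣ = {i : x i = -1}`. -/
noncomputable def negSet (n : ℕ) (x : Fin n → ℝ) : Finset (Fin n) :=
  Finset.univ.filter (fun i => x i = -1)

/-- The bisubmodular polyhedron `P_f`. -/
def bisubPolyhedron (n : ℕ) (f : Finset (Fin n) → Finset (Fin n) → ℝ) : Set (Fin n → ℝ) :=
  {π | ∀ S₁ S₂ : Finset (Fin n), Disjoint S₁ S₂ →
    (∑ i ∈ S₁, π i) - (∑ j ∈ S₂, π j) ≤ f S₁ S₂}

/-- `Q_f`, the convex hull of the epigraph of `f` over ternary vectors. -/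
noncomputable def epigraphQ (n : ℕ) (f : Finset (Fin n) → Finset (Fin n) → ℝ) :
    Set ((Fin n → ℝ) × ℝ) :=
  convexHull ℝ {p : (Fin n → ℝ) × ℝ |
    IsTernary n p.1 ∧ f (posSet n p.1) (negSet n p.1) ≤ p.2}

/-- `S₁ᵏ = {δ_j : j ≤ k (1-based), σ_{δ_j} = 1}` (here `j` ranges over `Fin n`, 0-based). -/
noncomputable def greedyS1 (n : ℕ) (δ : Equiv.Perm (Fin n)) (σ : Fin n → ℝ) (k : ℕ) :
    Finset (Fin n) :=
  (Finset.univ.filter (fun j : Fin n => (j : ℕ) < k ∧ σ (δ j) = 1)).image δ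

/-- `S₂ᵏ = {δ_j : j ≤ k (1-based), σ_{δ_j} = -1}`. -/
noncomputable def greedyS2 (n : ℕ) (δ : Equiv.Perm (Fin n)) (σ : Fin n → ℝ) (k : ℕ) :
    Finset (Fin n) :=
  (Finset.univ.filter (fun j : Fin n => (j : ℕ) < k ∧ σ (δ j) = -1)).image δ

/-- The signed greedy vector `π^{δ,σ}` for `f`:
`π_{δ_k} = σ_{δ_k} · (f(S₁ᵏ,S₂ᵏ) − f(S₁ᵏ⁻¹,S₂ᵏ⁻¹))`. -/
noncomputable def signedGreedy (n : ℕ) (f : Finset (Fin n) → Finset (Fin n) → ℝ)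
    (δ : Equiv.Perm (Fin n)) (σ : Fin n → ℝ) : Fin n → ℝ :=
  fun i => σ i *
    (f (greedyS1 n δ σ ((δ.symm i : ℕ) + 1)) (greedyS2 n δ σ ((δ.symm i : ℕ) + 1)) -
     f (greedyS1 n δ σ (δ.symm i : ℕ)) (greedyS2 n δ σ (δ.symm i : ℕ)))

section SubmodularGreedy

variable {ι : Type*} [Fintype ι] [DecidableEq ι]

/-- The elements of rank less than `k`. -/
def rankInitial (r : ι → ℕ) (k : ℕ) : Finset ι := univ.filter (fun i => r i < k)

/-- The marginal values of `g` along the chain of initial segments of the ranking `r`. -/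
def greedyMarginal (g : Finset ι → ℝ) (r : ι → ℕ) (i : ι) : ℝ :=
  g (rankInitial r (r i + 1)) - g (rankInitial r (r i))

lemma rankInitial_succ {r : ι → ℕ} (hr : r.Injective) (i : ι) :
    rankInitial r (r i + 1) = insert i (rankInitial r (r i)) := by
  ext j
  simp only [rankInitial, mem_filter, mem_univ, true_and, mem_insert, ← hr.eq_iff]
  omega

lemma sum_greedyMarginal_rankInitial (g : Finset ι → ℝ) (hg : g ∅ = 0) {r : ι → ℕ}
    (hr : r.Injective) (k : ℕ) :
    ∑ i ∈ rankInitial r k, greedyMarginal g r i = g (rankInitial r k) := by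
  induction k with
  | zero => simp [rankInitial, hg]
  | succ k ih =>
    by_cases h : ∃ i, r i = k
    · obtain ⟨i, rfl⟩ := h
      have hi : i ∉ rankInitial r (r i) := by simp [rankInitial]
      rw [rankInitial_succ hr, sum_insert hi, ih, greedyMarginal, rankInitial_succ hr]
      ring
    · have hT : rankInitial r (k + 1) = rankInitial r k := by
        ext j
        have : r j ≠ k := fun hj => h ⟨j, hj⟩
        simp only [rankInitial, mem_filter, mem_univ, true_and]
        omega
      rw [hT, ih]

lemma sum_greedyMarginal_le (g : Finset ι → ℝ) (hg : g ∅ = 0)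
    (hsub : ∀ S T, g (S ∩ T) + g (S ∪ T) ≤ g S + g T) {r : ι → ℕ}
    (hr : r.Injective) (S : Finset ι) : ∑ i ∈ S, greedyMarginal g r i ≤ g S := by
  induction S using Finset.induction_on_max_value r with
  | empty => simp [hg]
  | insert a s ha hmax ih =>
    have hlt : ∀ i ∈ s, r i < r a := fun i hi =>
      lt_of_le_of_ne (hmax i hi) fun h => ha (hr h ▸ hi)
    have hinter : insert a s ∩ rankInitial r (r a) = s := by
      ext i
      simp only [rankInitial, mem_inter, mem_insert, mem_filter, mem_univ, true_and]
      constructor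
      · rintro ⟨rfl | h, h'⟩
        · omega
        · exact h
      · exact fun h => ⟨Or.inr h, hlt i h⟩
    have hunion : insert a s ∪ rankInitial r (r a) = rankInitial r (r a + 1) := by
      rw [rankInitial_succ hr]
      ext i
      have := hlt i
      simp only [rankInitial, mem_union, mem_insert, mem_filter, mem_univ, true_and]
      tauto
    have := hsub (insert a s) (rankInitial r (r a))
    rw [hinter, hunion] at this
    rw [sum_insert ha, greedyMarginal]
    linarith

end SubmodularGreedy

section Signs

variable {n : ℕ}

/-- The sign vector that is `1` on `P` and `-1` off `P`. -/
def signOf (P : Finset (Fin n)) (i : Fin n) : ℝ := if i ∈ P then 1 else -1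

/-- The set function induced by `f` on the orthant with positive coordinates `P`. -/
def orthantRestrict (f : Finset (Fin n) → Finset (Fin n) → ℝ) (P S : Finset (Fin n)) : ℝ :=
  f (S ∩ P) (S \ P)

lemma signOf_mul_self (P : Finset (Fin n)) (i : Fin n) : signOf P i * signOf P i = 1 := by
  unfold signOf; split_ifs <;> norm_num

lemma sum_inter_sub_sum_sdiff (P S : Finset (Fin n)) (y : Fin n → ℝ) :
    ∑ i ∈ S ∩ P, y i - ∑ i ∈ S \ P, y i = ∑ i ∈ S, signOf P i * y i := by
  rw [← sum_inter_add_sum_sdiff S P (fun i => signOf P i * y i), sub_eq_add_neg,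
    ← sum_neg_distrib]
  congr 1
  · refine sum_congr rfl fun i hi => ?_
    simp [signOf, (mem_inter.1 hi).2]
  · refine sum_congr rfl fun i hi => ?_
    simp [signOf, (mem_sdiff.1 hi).2]

lemma Bisubmodular.orthantRestrict_submodular {f : Finset (Fin n) → Finset (Fin n) → ℝ}
    (hf : Bisubmodular n f) (P S T : Finset (Fin n)) :
    orthantRestrict f P (S ∩ T) + orthantRestrict f P (S ∪ T) ≤
      orthantRestrict f P S + orthantRestrict f P T := by
  have h := hf (S ∩ P) (S \ P) (T ∩ P) (T \ P)
    (disjoint_left.2 fun i => by simp +contextual) (disjoint_left.2 fun i => by simp +contextual)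
  convert h using 2 <;> unfold orthantRestrict <;> congr 1 <;> ext i <;>
    simp only [mem_inter, mem_sdiff, mem_union] <;> tauto

/-- The greedy vector of the ranking `r` in the orthant with positive coordinates `P`. -/
def orthantGreedy (f : Finset (Fin n) → Finset (Fin n) → ℝ) (P : Finset (Fin n))
    (r : Fin n → ℕ) (i : Fin n) : ℝ :=
  signOf P i * greedyMarginal (orthantRestrict f P) r i

lemma orthantGreedy_mem_bisubPolyhedron {f : Finset (Fin n) → Finset (Fin n) → ℝ}
    (hf : Bisubmodular n f) (hf0 : f ∅ ∅ = 0) (P : Finset (Fin n)) {r : Fin n → ℕ}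
    (hr : r.Injective) (hrn : ∀ i, r i < n) :
    orthantGreedy f P r ∈ bisubPolyhedron n f := by
  intro S₁ S₂ hS
  have hdisj := disjoint_left.1 hS
  have hg0 : orthantRestrict f P ∅ = 0 := by simpa [orthantRestrict] using hf0
  have hle := sum_greedyMarginal_le _ hg0 (hf.orthantRestrict_submodular P) hr
  have huniv := sum_greedyMarginal_rankInitial _ hg0 hr n
  rw [show rankInitial r n = univ by simp [rankInitial, hrn]] at huniv
  have hmeet := hle (S₁ ∩ P ∪ S₂ \ P)
  have hjoin := hle (P \ S₂ ∪ Pᶜ \ S₁)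
  have hbisub := hf S₁ S₂ P Pᶜ hS disjoint_compl_right
  have hfmeet : orthantRestrict f P (S₁ ∩ P ∪ S₂ \ P) = f (S₁ ∩ P) (S₂ ∩ Pᶜ) := by
    unfold orthantRestrict
    congr 1 <;> ext i <;> simp only [mem_inter, mem_sdiff, mem_union, mem_compl] <;> tauto
  have hfjoin : orthantRestrict f P (P \ S₂ ∪ Pᶜ \ S₁) =
      f ((S₁ ∪ P) \ (S₂ ∪ Pᶜ)) ((S₂ ∪ Pᶜ) \ (S₁ ∪ P)) := by
    unfold orthantRestrict
    congr 1 <;> ext i <;> simp only [mem_inter, mem_sdiff, mem_union, mem_compl] <;> tauto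
  have hfuniv : orthantRestrict f P univ = f P Pᶜ := by
    unfold orthantRestrict
    simp [compl_eq_univ_sdiff]
  have hsum : (∑ i ∈ S₁, orthantGreedy f P r i) - ∑ i ∈ S₂, orthantGreedy f P r i +
      ∑ i, greedyMarginal (orthantRestrict f P) r i =
      ∑ i ∈ S₁ ∩ P ∪ S₂ \ P, greedyMarginal (orthantRestrict f P) r i +
      ∑ i ∈ P \ S₂ ∪ Pᶜ \ S₁, greedyMarginal (orthantRestrict f P) r i := by
    have key : ∀ (S : Finset (Fin n)) (h : Fin n → ℝ),
        ∑ i ∈ S, h i = ∑ i, if i ∈ S then h i else 0 := fun S h => by simp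
    rw [key S₁, key S₂, key (S₁ ∩ P ∪ S₂ \ P), key (P \ S₂ ∪ Pᶜ \ S₁), ← sum_sub_distrib,
      ← sum_add_distrib, ← sum_add_distrib]
    refine sum_congr rfl fun i _ => ?_
    have := @hdisj i
    by_cases h₁ : i ∈ S₁ <;> by_cases h₂ : i ∈ S₂ <;> by_cases hP : i ∈ P <;>
      simp_all [orthantGreedy, signOf]
  linarith

lemma sum_signOf_mul_le_of_mem {f : Finset (Fin n) → Finset (Fin n) → ℝ} {y : Fin n → ℝ}
    (hy : y ∈ bisubPolyhedron n f) (P S : Finset (Fin n)) :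
    ∑ i ∈ S, signOf P i * y i ≤ orthantRestrict f P S := by
  rw [← sum_inter_sub_sum_sdiff]
  exact hy _ _ (disjoint_left.2 fun i => by simp +contextual)

lemma orthantGreedy_mem_extremePoints {f : Finset (Fin n) → Finset (Fin n) → ℝ}
    (hf : Bisubmodular n f) (hf0 : f ∅ ∅ = 0) (P : Finset (Fin n)) {r : Fin n → ℕ}
    (hr : r.Injective) (hrn : ∀ i, r i < n) :
    orthantGreedy f P r ∈ (bisubPolyhedron n f).extremePoints ℝ := by
  refine ⟨orthantGreedy_mem_bisubPolyhedron hf hf0 P hr hrn, ?_⟩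
  rintro y hy z hz ⟨a, b, ha, hb, hab, hyz⟩
  have hg0 : orthantRestrict f P ∅ = 0 := by simpa [orthantRestrict] using hf0
  have htight : ∀ k, ∑ i ∈ rankInitial r k, signOf P i * y i =
      orthantRestrict f P (rankInitial r k) := by
    intro k
    have h₁ := sum_signOf_mul_le_of_mem hy P (rankInitial r k)
    have h₂ := sum_signOf_mul_le_of_mem hz P (rankInitial r k)
    have h₃ : a * ∑ i ∈ rankInitial r k, signOf P i * y i +
        b * ∑ i ∈ rankInitial r k, signOf P i * z i =
        orthantRestrict f P (rankInitial r k) := by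
      rw [← sum_greedyMarginal_rankInitial _ hg0 hr k, mul_sum, mul_sum, ← sum_add_distrib]
      refine sum_congr rfl fun i _ => ?_
      have hi := congrFun hyz i
      simp only [Pi.add_apply, Pi.smul_apply, smul_eq_mul, orthantGreedy] at hi
      linear_combination signOf P i * hi +
        greedyMarginal (orthantRestrict f P) r i * signOf_mul_self P i
    refine le_antisymm h₁ (le_of_mul_le_mul_left ?_ ha)
    have h₄ := mul_le_mul_of_nonneg_left h₂ hb.le
    obtain rfl : b = 1 - a := by linarith
    linarith
  ext i
  have h₁ := htight (r i + 1)
  have hi : i ∉ rankInitial r (r i) := by simp [rankInitial]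
  rw [rankInitial_succ hr, sum_insert hi, htight (r i), ← rankInitial_succ hr] at h₁
  simp only [orthantGreedy, greedyMarginal]
  linear_combination signOf P i * h₁ - y i * signOf_mul_self P i

end Signs

/-- A vector in the unit cube is a convex combination of the indicators of the initial segments
of a ranking that sorts its entries in decreasing order. -/
lemma exists_rankInitial_convexCombination {n : ℕ} (a : Fin n → ℝ) (h0 : ∀ i, 0 ≤ a i)
    (h1 : ∀ i, a i ≤ 1) :
    ∃ (r : Fin n → ℕ) (c : ℕ → ℝ), r.Injective ∧ (∀ i, r i < n) ∧ (∀ k, 0 ≤ c k) ∧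
      ∑ k ∈ range (n + 1), c k = 1 ∧
      ∀ i, ∑ k ∈ range (n + 1), (if i ∈ rankInitial r k then c k else 0) = a i := by
  set δ := Tuple.sort (fun i => -a i) with hδ
  have hmono : ∀ i j, i ≤ j → a (δ j) ≤ a (δ i) := fun i j hij => by
    have := Tuple.monotone_sort (fun i => -a i) hij
    simpa using this
  let b : ℕ → ℝ := fun k => if k = 0 then 1 else if h : k - 1 < n then a (δ ⟨k - 1, h⟩) else 0
  have hb : ∀ k, b (k + 1) ≤ b k := by
    intro k
    rcases k with _ | k
    · simp only [b]
      split_ifs <;> simp_all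
    · by_cases h : k + 1 < n
      · have h' : k < n := by omega
        simpa [b, h, h'] using hmono ⟨k, h'⟩ ⟨k + 1, h⟩ (by simp)
      · by_cases h' : k < n <;> simp [b, h, h', h0]
  have hbn : b (n + 1) = 0 := by simp [b]
  refine ⟨fun i => δ.symm i, fun k => b k - b (k + 1),
    Fin.val_injective.comp δ.symm.injective, fun i => (δ.symm i).2,
    fun k => sub_nonneg.2 (hb k), ?_, fun i => ?_⟩
  · rw [sum_range_sub', hbn]
    simp [b]
  · have hlt := (δ.symm i).2
    have hIco : (range (n + 1)).filter (fun k => i ∈ rankInitial (fun i => (δ.symm i : ℕ)) k) =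
        Ico ((δ.symm i : ℕ) + 1) (n + 1) := by
      ext k
      simp only [rankInitial, mem_filter, mem_range, mem_univ, true_and, mem_Ico]
      omega
    rw [← sum_filter, hIco, ← neg_inj, ← sum_neg_distrib]
    simp only [neg_sub]
    rw [sum_Ico_sub b (by omega), hbn]
    simp [b]

lemma mem_posSet {n : ℕ} {x : Fin n → ℝ} {i : Fin n} : i ∈ posSet n x ↔ x i = 1 := by
  simp [posSet]

lemma mem_negSet {n : ℕ} {x : Fin n → ℝ} {i : Fin n} : i ∈ negSet n x ↔ x i = -1 := by
  simp [negSet]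

lemma posSet_indicator_signOf {n : ℕ} (P S : Finset (Fin n)) :
    posSet n (fun i => if i ∈ S then signOf P i else 0) = S ∩ P := by
  ext i
  rw [mem_posSet]
  by_cases hS : i ∈ S <;> by_cases hP : i ∈ P <;> norm_num [signOf, hS, hP]

lemma negSet_indicator_signOf {n : ℕ} (P S : Finset (Fin n)) :
    negSet n (fun i => if i ∈ S then signOf P i else 0) = S \ P := by
  ext i
  rw [mem_negSet]
  by_cases hS : i ∈ S <;> by_cases hP : i ∈ P <;> norm_num [signOf, hS, hP]

lemma sum_mul_eq_of_isTernary {n : ℕ} {x : Fin n → ℝ} (hx : IsTernary n x) (π : Fin n → ℝ) :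
    ∑ i, π i * x i = ∑ i ∈ posSet n x, π i - ∑ i ∈ negSet n x, π i := by
  rw [posSet, negSet, sum_filter, sum_filter, ← sum_sub_distrib]
  refine sum_congr rfl fun i _ => ?_
  rcases hx i with h | h | h <;> norm_num [h]

/-- `Q_f` is described by the trivial inequalities together with
the extremal poly-bimatroid inequalities. -/
theorem stmt3 (n : ℕ) (hn : 0 < n) (f : Finset (Fin n) → Finset (Fin n) → ℝ)
    (hf : Bisubmodular n f) (hf0 : f ∅ ∅ = 0) :
    epigraphQ n f =
      {p : (Fin n → ℝ) × ℝ |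
        (∀ i, -1 ≤ p.1 i ∧ p.1 i ≤ 1) ∧
        ∀ π ∈ (bisubPolyhedron n f).extremePoints ℝ, ∑ i, π i * p.1 i ≤ p.2} := by
  apply Set.Subset.antisymm
  · refine convexHull_min ?_ ?_
    · rintro ⟨x, z⟩ ⟨hx, hz⟩
      refine ⟨fun i => ?_, fun π hπ => ?_⟩
      · rcases hx i with h | h | h <;> rw [h] <;> norm_num
      · rw [sum_mul_eq_of_isTernary hx]
        refine (hπ.1 _ _ (disjoint_left.2 fun i hi hi' => ?_)).trans hz
        rw [mem_posSet] at hi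
        rw [mem_negSet] at hi'
        linarith
    · rintro ⟨x, z⟩ ⟨hx, hxz⟩ ⟨y, w⟩ ⟨hy, hyw⟩ a b ha hb hab
      refine ⟨fun i => ?_, fun π hπ => ?_⟩
      · obtain ⟨hx₁, hx₂⟩ := hx i
        obtain ⟨hy₁, hy₂⟩ := hy i
        simp only [Prod.fst_add, Prod.smul_fst, Pi.add_apply, Pi.smul_apply, smul_eq_mul] at *
        constructor <;> nlinarith
      · have h₁ := mul_le_mul_of_nonneg_left (hxz π hπ) ha
        have h₂ := mul_le_mul_of_nonneg_left (hyw π hπ) hb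
        rw [mul_sum] at h₁ h₂
        refine le_trans (le_of_eq ?_) (add_le_add h₁ h₂)
        rw [← sum_add_distrib]
        refine sum_congr rfl fun i _ => ?_
        simp only [Prod.fst_add, Prod.smul_fst, Pi.add_apply, Pi.smul_apply, smul_eq_mul]
        ring
  · rintro ⟨x, z⟩ ⟨hx, hxz⟩
    obtain ⟨r, c, hr, hrn, hc, hc1, hca⟩ := exists_rankInitial_convexCombination
      (fun i => |x i|) (fun i => abs_nonneg _) (fun i => abs_le.2 (hx i))
    let P : Finset (Fin n) := univ.filter (fun i => 0 ≤ x i)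
    have hsign : ∀ i, signOf P i * |x i| = x i := by
      intro i
      by_cases h : 0 ≤ x i
      · simp [signOf, P, h, abs_of_nonneg]
      · simp [signOf, P, h, abs_of_neg (not_le.1 h)]
    have hg0 : orthantRestrict f P ∅ = 0 := by simpa [orthantRestrict] using hf0
    have hz := hxz _ (orthantGreedy_mem_extremePoints hf hf0 P hr hrn)
    have hvalue : ∑ k ∈ range (n + 1), c k * orthantRestrict f P (rankInitial r k) =
        ∑ i, orthantGreedy f P r i * x i := by
      calc ∑ k ∈ range (n + 1), c k * orthantRestrict f P (rankInitial r k)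
          = ∑ k ∈ range (n + 1), ∑ i, greedyMarginal (orthantRestrict f P) r i *
              (if i ∈ rankInitial r k then c k else 0) := by
            refine sum_congr rfl fun k _ => ?_
            rw [← sum_greedyMarginal_rankInitial _ hg0 hr k, mul_sum]
            simp [mul_comm]
        _ = ∑ i, orthantGreedy f P r i * x i := by
            rw [sum_comm]
            refine sum_congr rfl fun i _ => ?_
            rw [← mul_sum, hca, orthantGreedy]
            linear_combination signOf P i * greedyMarginal (orthantRestrict f P) r i * hsign i -
              greedyMarginal (orthantRestrict f P) r i * |x i| * signOf_mul_self P i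
    set gap : ℝ := z - ∑ i, orthantGreedy f P r i * x i with hgap
    have hgap0 : 0 ≤ gap := sub_nonneg.2 hz
    let v : ℕ → (Fin n → ℝ) × ℝ := fun k =>
      (fun i => if i ∈ rankInitial r k then signOf P i else 0,
        orthantRestrict f P (rankInitial r k) + gap)
    have hv : ∀ k, v k ∈ epigraphQ n f := by
      refine fun k => subset_convexHull ℝ _ ⟨fun i => ?_, ?_⟩
      · simp only [v, signOf]
        split_ifs <;> simp
      · simp only [v, posSet_indicator_signOf, negSet_indicator_signOf]
        exact le_add_of_nonneg_right hgap0
    have hcomb : ∑ k ∈ range (n + 1), c k • v k = (x, z) := by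
      refine Prod.ext (funext fun i => ?_) ?_
      · rw [Prod.fst_sum, Finset.sum_apply]
        simp only [v, Prod.smul_fst, Pi.smul_apply, smul_eq_mul]
        rw [← hsign i, ← hca i, mul_sum]
        refine sum_congr rfl fun k _ => ?_
        split_ifs <;> ring
      · rw [Prod.snd_sum]
        simp only [v, Prod.smul_snd, smul_eq_mul, mul_add, sum_add_distrib, hvalue, ← sum_mul,
          hc1, hgap]
        ring
    rw [← hcomb]
    exact (convex_convexHull ℝ _).sum_mem (fun k _ => hc k) hc1 (fun k _ => hv k)
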